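/- Let n ≥ 3. The set 𝒫_n^n = {z^n : z ∈ 𝒫_n} equals the convex hull in ℂ of the boundary curve { −(sec(θ/n)/sec(π/n))^n · exp(iθ) : θ ∈ [−π, π] }. -/

import Mathlib

theorem pow_mul_le_mean_pow (m : ℕ) {x y : ℝ} (hx : 0 ≤ x) (hy : 0 ≤ y) :
    x ^ m * y ≤ ((m * x + y) / (m + 1)) ^ (m + 1) := by
  have hm : (0 : ℝ) < m + 1 := by positivity
  have h := Real.geom_mean_le_arith_mean2_weighted (w₁ := m / (m + 1)) (w₂ := 1 / (m + 1))
    (by positivity) (by positivity) hx hy (by field_simp)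
  have h2 := pow_le_pow_left₀ (by positivity) h (m + 1)
  have e1 : (x ^ ((m : ℝ) / (m + 1)) * y ^ ((1 : ℝ) / (m + 1))) ^ (m + 1) = x ^ m * y := by
    rw [mul_pow, ← Real.rpow_mul_natCast hx, ← Real.rpow_mul_natCast hy]
    push_cast
    rw [div_mul_cancel₀ _ hm.ne', div_mul_cancel₀ _ hm.ne', Real.rpow_natCast, Real.rpow_one]
  rw [e1] at h2
  rwa [show ((m : ℝ) * x + y) / (m + 1) = m / (m + 1) * x + 1 / (m + 1) * y by ring]

theorem cos_pow_mul_cos_le_cos_mean_pow (m : ℕ) {a b : ℝ}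
    (ha : a ∈ Set.Icc (-(Real.pi / 2)) (Real.pi / 2))
    (hb : b ∈ Set.Icc (-(Real.pi / 2)) (Real.pi / 2)) :
    Real.cos a ^ m * Real.cos b ≤ Real.cos ((m * a + b) / (m + 1)) ^ (m + 1) := by
  have hm : (0 : ℝ) < m + 1 := by positivity
  have ca := Real.cos_nonneg_of_mem_Icc ha
  have cb := Real.cos_nonneg_of_mem_Icc hb
  refine (pow_mul_le_mean_pow m ca cb).trans (pow_le_pow_left₀ (by positivity) ?_ _)
  have h0 : 0 ≤ (m : ℝ) / (m + 1) := by positivity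
  have h1 : 0 ≤ 1 / ((m : ℝ) + 1) := by positivity
  have h := strictConcaveOn_cos_Icc.concaveOn.right ha hb h0 h1 (by field_simp)
  simp only [smul_eq_mul] at h
  rwa [show (m * Real.cos a + Real.cos b) / ((m : ℝ) + 1) =
      m / (m + 1) * Real.cos a + 1 / (m + 1) * Real.cos b by ring,
    show (m * a + b) / ((m : ℝ) + 1) = m / (m + 1) * a + 1 / (m + 1) * b by ring]

theorem cos_pow_mul_cos_sub_le_of_nonneg (m : ℕ) (hm : 2 ≤ m) {θ φ : ℝ}
    (hθ : θ ∈ Set.Icc (-Real.pi) Real.pi)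
    (hφ : φ ∈ Set.Icc (-(Real.pi / (m + 1))) (Real.pi / (m + 1))) (h0 : 0 ≤ θ - m * φ) :
    Real.cos φ ^ m * Real.cos (θ - m * φ) ≤ Real.cos (θ / (m + 1)) ^ (m + 1) := by
  have hpi := Real.pi_pos
  have hm2 : (2 : ℝ) ≤ m := by exact_mod_cast hm
  have hp : (0 : ℝ) < m + 1 := by positivity
  have hle : Real.pi / (m + 1) ≤ Real.pi / 2 :=
    div_le_div_of_nonneg_left hpi.le (by norm_num) (by linarith)
  have hφ' : φ ∈ Set.Icc (-(Real.pi / 2)) (Real.pi / 2) := ⟨by linarith [hφ.1], by linarith [hφ.2]⟩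
  have hφc : 0 ≤ Real.cos φ := Real.cos_nonneg_of_mem_Icc hφ'
  have hθ1 : -(Real.pi / (m + 1)) ≤ θ / (m + 1) := by
    rw [← neg_div]; exact div_le_div_of_nonneg_right hθ.1 hp.le
  have hθ2 : θ / (m + 1) ≤ Real.pi / (m + 1) := div_le_div_of_nonneg_right hθ.2 hp.le
  have hθc : 0 ≤ Real.cos (θ / (m + 1)) :=
    Real.cos_nonneg_of_mem_Icc ⟨by linarith, by linarith⟩
  rcases le_total (θ - m * φ) (Real.pi / 2) with h1 | h1
  · have h := cos_pow_mul_cos_le_cos_mean_pow m hφ' (b := θ - m * φ) ⟨by linarith, h1⟩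
    simpa using h
  rcases le_total (θ - m * φ) (Real.pi + Real.pi / 2) with h2 | h2
  · have hc := Real.cos_nonpos_of_pi_div_two_le_of_le h1 h2
    exact (mul_nonpos_of_nonneg_of_nonpos (pow_nonneg hφc m) hc).trans (pow_nonneg hθc _)
  have hmφ : -(m * φ) ≤ Real.pi := by
    have h3 : (m + 1) * (-φ) ≤ Real.pi := by
      have := mul_le_mul_of_nonneg_left hφ.1 hp.le
      have e : ((m : ℝ) + 1) * -(Real.pi / (m + 1)) = -Real.pi := by field_simp
      linarith
    have h4 : φ ≤ 0 := by
      by_contra! h5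
      have : 0 ≤ (m : ℝ) * φ := by positivity
      linarith [hθ.2]
    linarith
  have hψ : θ - m * φ - 2 * Real.pi ∈ Set.Icc (-(Real.pi / 2)) (Real.pi / 2) :=
    ⟨by linarith, by linarith [hθ.2]⟩
  have h := cos_pow_mul_cos_le_cos_mean_pow m hφ' hψ
  rw [Real.cos_sub_two_pi] at h
  have e : (m * φ + (θ - m * φ - 2 * Real.pi)) / ((m : ℝ) + 1) =
      -(2 * (Real.pi / (m + 1)) - θ / (m + 1)) := by ring
  rw [e, Real.cos_neg] at h
  have hu : 2 * (Real.pi / (m + 1)) - θ / (m + 1) ≤ Real.pi := by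
    have : Real.pi / (m + 1) ≤ Real.pi / 3 :=
      div_le_div_of_nonneg_left hpi.le (by norm_num) (by linarith)
    linarith
  have hmono : Real.cos (2 * (Real.pi / (m + 1)) - θ / (m + 1)) ≤ Real.cos (θ / (m + 1)) := by
    rw [← Real.cos_abs (θ / (m + 1))]
    exact Real.cos_le_cos_of_nonneg_of_le_pi (abs_nonneg _) hu
      (abs_le.2 ⟨by linarith, by linarith⟩)
  refine h.trans (pow_le_pow_left₀ ?_ hmono _)
  have h1' := Real.cos_nonneg_of_mem_Icc (x := (m * φ + (θ - m * φ - 2 * Real.pi)) / ((m : ℝ) + 1))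
    ⟨by rw [le_div_iff₀ hp]; nlinarith [hψ.1, hφ'.1], by rw [div_le_iff₀ hp]; nlinarith [hψ.2, hφ'.2]⟩
  rwa [e, Real.cos_neg] at h1'

theorem cos_pow_mul_cos_sub_le (n : ℕ) (hn : 3 ≤ n) {θ φ : ℝ}
    (hθ : θ ∈ Set.Icc (-Real.pi) Real.pi)
    (hφ : φ ∈ Set.Icc (-(Real.pi / n)) (Real.pi / n)) :
    Real.cos φ ^ (n - 1) * Real.cos (θ - (n - 1) * φ) ≤ Real.cos (θ / n) ^ n := by
  obtain ⟨m, rfl⟩ : ∃ m, n = m + 1 := ⟨n - 1, by omega⟩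
  push_cast at *
  simp only [add_sub_cancel_right] at *
  rcases le_total 0 (θ - m * φ) with h | h
  · exact cos_pow_mul_cos_sub_le_of_nonneg m (by omega) hθ hφ h
  · have := cos_pow_mul_cos_sub_le_of_nonneg m (by omega) (θ := -θ) (φ := -φ)
      ⟨by linarith [hθ.2], by linarith [hθ.1]⟩ ⟨by linarith [hφ.2], by linarith [hφ.1]⟩
      (by linarith)
    rwa [show -θ - m * -φ = -(θ - m * φ) by ring, neg_div, Real.cos_neg, Real.cos_neg,
      Real.cos_neg] at this

theorem cos_odd_mul_pi_div_le (n : ℕ) (hn : 0 < n) (m : ℤ) :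
    Real.cos ((2 * m + 1) * (Real.pi / n)) ≤ Real.cos (Real.pi / n) := by
  have hpi := Real.pi_pos
  have hn' : (0 : ℝ) < n := by exact_mod_cast hn
  set q := m / (n : ℤ)
  set r := m % (n : ℤ)
  have hm : (m : ℝ) = r + q * n := by
    have := Int.emod_add_mul_ediv m n
    rw [← this]; push_cast; ring
  have hr0 : (0 : ℝ) ≤ r := by exact_mod_cast Int.emod_nonneg m (by omega)
  have hr1 : (r : ℝ) + 1 ≤ n := by exact_mod_cast Int.emod_lt_of_pos m (by omega)
  have hd : 0 ≤ Real.pi / n := by positivity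
  have e : (n : ℝ) * (Real.pi / n) = Real.pi := by field_simp
  have key : Real.cos (Real.pi / n) - Real.cos ((2 * r + 1) * (Real.pi / n)) =
      2 * Real.sin ((r + 1) * (Real.pi / n)) * Real.sin (r * (Real.pi / n)) := by
    rw [Real.cos_sub_cos,
      show (Real.pi / n + (2 * r + 1) * (Real.pi / n)) / 2 = (r + 1) * (Real.pi / n) by ring,
      show (Real.pi / n - (2 * r + 1) * (Real.pi / n)) / 2 = -(r * (Real.pi / n)) by ring,
      Real.sin_neg]
    ring
  have e2 : (2 * (m : ℝ) + 1) * (Real.pi / n) = (2 * r + 1) * (Real.pi / n) + q * (2 * Real.pi) := by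
    rw [hm]; linear_combination 2 * q * e
  rw [e2, Real.cos_add_int_mul_two_pi]
  have s1 : 0 ≤ Real.sin ((r + 1) * (Real.pi / n)) :=
    Real.sin_nonneg_of_nonneg_of_le_pi (by positivity) (by nlinarith)
  have s2 : 0 ≤ Real.sin (r * (Real.pi / n)) :=
    Real.sin_nonneg_of_nonneg_of_le_pi (by positivity) (by nlinarith)
  have : 0 ≤ 2 * Real.sin ((r + 1) * (Real.pi / n)) * Real.sin (r * (Real.pi / n)) := by positivity
  linarith

/-- The intersection of the half-planes bounded by the tangent lines of the secant curve. -/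
def secantHalfPlanes (n : ℕ) : Set ℂ :=
  {w : ℂ | ∀ φ ∈ Set.Icc (-(Real.pi / n)) (Real.pi / n),
    Real.cos φ ^ (n - 1) * (-w.re * Real.cos ((n - 1) * φ) - w.im * Real.sin ((n - 1) * φ)) ≤
      Real.cos (Real.pi / n) ^ n}

theorem convex_secantHalfPlanes (n : ℕ) : Convex ℝ (secantHalfPlanes n) := by
  intro x hx y hy a b ha hb hab φ hφ
  have h1 := mul_le_mul_of_nonneg_left (hx φ hφ) ha
  have h2 := mul_le_mul_of_nonneg_left (hy φ hφ) hb
  have e : Real.cos (Real.pi / n) ^ n =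
      a * Real.cos (Real.pi / n) ^ n + b * Real.cos (Real.pi / n) ^ n := by
    rw [← add_mul, hab, one_mul]
  rw [e]
  refine le_trans (le_of_eq ?_) (add_le_add h1 h2)
  simp only [Complex.add_re, Complex.add_im, Complex.smul_re, Complex.smul_im, smul_eq_mul]
  ring

theorem exists_eq_neg_mul_exp (w : ℂ) :
    ∃ ρ θ : ℝ, 0 ≤ ρ ∧ θ ∈ Set.Icc (-Real.pi) Real.pi ∧ w = -(ρ : ℂ) * Complex.exp (θ * Complex.I) :=
  ⟨‖-w‖, (-w).arg, norm_nonneg _, ⟨(Complex.neg_pi_lt_arg _).le, Complex.arg_le_pi _⟩, by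
    rw [neg_mul, Complex.norm_mul_exp_arg_mul_I, neg_neg]⟩

theorem neg_mul_exp_mem_secantHalfPlanes_iff (n : ℕ) (hn : 3 ≤ n) {ρ θ : ℝ} (hρ : 0 ≤ ρ)
    (hθ : θ ∈ Set.Icc (-Real.pi) Real.pi) :
    -(ρ : ℂ) * Complex.exp (θ * Complex.I) ∈ secantHalfPlanes n ↔
      ρ * Real.cos (θ / n) ^ n ≤ Real.cos (Real.pi / n) ^ n := by
  have hn' : (0 : ℝ) < n := by exact_mod_cast (by omega : 0 < n)
  have e (φ : ℝ) : Real.cos φ ^ (n - 1) * (-(-(ρ : ℂ) * Complex.exp (θ * Complex.I)).re *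
      Real.cos ((n - 1) * φ) - (-(ρ : ℂ) * Complex.exp (θ * Complex.I)).im *
      Real.sin ((n - 1) * φ)) = ρ * (Real.cos φ ^ (n - 1) * Real.cos (θ - (n - 1) * φ)) := by
    rw [← Complex.ofReal_neg, Complex.re_ofReal_mul, Complex.im_ofReal_mul,
      Complex.exp_ofReal_mul_I_re, Complex.exp_ofReal_mul_I_im, Real.cos_sub]
    ring
  simp only [secantHalfPlanes, Set.mem_ofPred_eq, e]
  constructor
  · intro h
    have h1 := h (θ / n) ⟨by rw [← neg_div]; exact div_le_div_of_nonneg_right hθ.1 hn'.le,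
      div_le_div_of_nonneg_right hθ.2 hn'.le⟩
    have e1 : θ - (n - 1) * (θ / n) = θ / n := by field_simp; ring
    rwa [e1, pow_sub_one_mul (by omega)] at h1
  · intro h φ hφ
    exact (mul_le_mul_of_nonneg_left (cos_pow_mul_cos_sub_le n hn hθ hφ) hρ).trans h

theorem exp_pow_eq_exp_mul_I (n k : ℕ) :
    Complex.exp (2 * Real.pi * Complex.I / n) ^ k =
      Complex.exp ((2 * k * (Real.pi / n) : ℝ) * Complex.I) := by
  rw [← Complex.exp_nat_mul]
  congr 1
  push_cast
  ring

theorem pow_mem_secantHalfPlanes (n : ℕ) (hn : 3 ≤ n) {z : ℂ}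
    (hz : z ∈ convexHull ℝ
      {w : ℂ | ∃ k < n, w = Complex.exp (2 * Real.pi * Complex.I / n) ^ k}) :
    z ^ n ∈ secantHalfPlanes n := by
  have hpi := Real.pi_pos
  have hn' : (0 : ℝ) < n := by exact_mod_cast (by omega : 0 < n)
  set d : ℝ := Real.pi / n with hd
  have hdn : n * d = Real.pi := by rw [hd]; field_simp
  have hdpos : 0 < d := by positivity
  set k : ℤ := ⌊z.arg / (2 * d)⌋ with hk
  set φ : ℝ := z.arg - (2 * k + 1) * d with hφ
  have hφ1 : -d ≤ φ := by
    have := (le_div_iff₀ (by positivity)).1 (Int.floor_le (z.arg / (2 * d)))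
    rw [← hk] at this
    rw [hφ]; linarith
  have hφ2 : φ ≤ d := by
    have := (div_lt_iff₀ (by positivity)).1 (Int.lt_floor_add_one (z.arg / (2 * d)))
    rw [← hk] at this
    rw [hφ]; linarith
  have hz1 : z = ‖z‖ * Complex.exp ((φ + (2 * k + 1) * d : ℝ) * Complex.I) := by
    rw [hφ, sub_add_cancel, Complex.norm_mul_exp_arg_mul_I]
  have hzn : z ^ n = -((‖z‖ ^ n : ℝ) : ℂ) * Complex.exp ((n * φ : ℝ) * Complex.I) := by
    conv_lhs => rw [hz1]
    rw [mul_pow, ← Complex.exp_nat_mul]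
    have hdn' : (n : ℂ) * d = Real.pi := by exact_mod_cast hdn
    have e : (n : ℂ) * ((φ + (2 * k + 1) * d : ℝ) * Complex.I) =
        (n * φ : ℝ) * Complex.I + Real.pi * Complex.I + k * (2 * Real.pi * Complex.I) := by
      push_cast
      linear_combination (2 * k + 1) * Complex.I * hdn'
    rw [e, Complex.exp_add, Complex.exp_int_mul_two_pi_mul_I, Complex.exp_add, Complex.exp_pi_mul_I]
    push_cast
    ring
  rw [hzn, neg_mul_exp_mem_secantHalfPlanes_iff n hn (by positivity)
    ⟨by nlinarith, by nlinarith⟩, mul_div_cancel_left₀ _ hn'.ne', ← mul_pow]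
  have hd3 : d ≤ Real.pi / 2 :=
    div_le_div_of_nonneg_left hpi.le (by norm_num) (by exact_mod_cast (by omega : 2 ≤ n))
  refine pow_le_pow_left₀ (mul_nonneg (norm_nonneg _)
    (Real.cos_nonneg_of_mem_Icc ⟨by linarith, by linarith⟩)) ?_ n
  have hsub : convexHull ℝ
      {w : ℂ | ∃ k < n, w = Complex.exp (2 * Real.pi * Complex.I / n) ^ k} ⊆
      {w : ℂ | w.re * Real.cos ((2 * k + 1) * d) + w.im * Real.sin ((2 * k + 1) * d) ≤
        Real.cos d} := by
    refine convexHull_min ?_ ?_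
    · rintro w ⟨j, -, rfl⟩
      simp only [Set.mem_ofPred_eq]
      rw [exp_pow_eq_exp_mul_I, Complex.exp_ofReal_mul_I_re, Complex.exp_ofReal_mul_I_im,
        ← Real.cos_sub]
      have := cos_odd_mul_pi_div_le n (by omega) (j - k - 1)
      push_cast at this
      rw [← hd] at this ⊢
      convert this using 2
      ring
    · intro x hx y hy a b ha hb hab
      have h1 := mul_le_mul_of_nonneg_left hx ha
      have h2 := mul_le_mul_of_nonneg_left hy hb
      have e : Real.cos d = a * Real.cos d + b * Real.cos d := by rw [← add_mul, hab, one_mul]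
      simp only [Set.mem_ofPred_eq]
      rw [e]
      refine le_trans (le_of_eq ?_) (add_le_add h1 h2)
      simp only [Complex.add_re, Complex.add_im, Complex.smul_re, Complex.smul_im, smul_eq_mul]
      ring
  have h := hsub hz
  simp only [Set.mem_ofPred_eq] at h
  have hre : z.re = ‖z‖ * Real.cos z.arg := (Complex.norm_mul_cos_arg z).symm
  have him : z.im = ‖z‖ * Real.sin z.arg := (Complex.norm_mul_sin_arg z).symm
  rw [hφ, Real.cos_sub]
  rw [hre, him] at h
  linarith

theorem zero_mem_convexHull_roots (n : ℕ) (hn : 2 ≤ n) :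
    (0 : ℂ) ∈ convexHull ℝ
      {w : ℂ | ∃ k < n, w = Complex.exp (2 * Real.pi * Complex.I / n) ^ k} := by
  have hn' : (0 : ℝ) < n := by exact_mod_cast (by omega : 0 < n)
  have hs := (Complex.isPrimitiveRoot_exp n (by omega)).geom_sum_eq_zero (by omega)
  have h := (convex_convexHull ℝ
    {w : ℂ | ∃ k < n, w = Complex.exp (2 * Real.pi * Complex.I / n) ^ k}).sum_mem
    (t := Finset.range n) (w := fun _ => (1 : ℝ) / n)
    (z := fun k => Complex.exp (2 * Real.pi * Complex.I / n) ^ k)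
    (fun _ _ => by positivity) (by simp; field_simp)
    (fun k hk => subset_convexHull ℝ _ ⟨k, Finset.mem_range.1 hk, rfl⟩)
  rwa [← Finset.smul_sum, hs, smul_zero] at h

theorem mul_exp_mem_convexHull_roots (n : ℕ) (hn : 3 ≤ n) {r φ : ℝ} (hr : 0 ≤ r)
    (hφ : φ ∈ Set.Icc (-(Real.pi / n)) (Real.pi / n))
    (h : r * Real.cos φ ≤ Real.cos (Real.pi / n)) :
    (r : ℂ) * Complex.exp ((φ + Real.pi / n : ℝ) * Complex.I) ∈ convexHull ℝ
      {w : ℂ | ∃ k < n, w = Complex.exp (2 * Real.pi * Complex.I / n) ^ k} := by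
  have hpi := Real.pi_pos
  have hn' : (0 : ℝ) < n := by exact_mod_cast (by omega : 0 < n)
  set d : ℝ := Real.pi / n with hd
  have hdpos : 0 < d := by positivity
  have hd3 : d ≤ Real.pi / 3 :=
    div_le_div_of_nonneg_left hpi.le (by norm_num) (by exact_mod_cast hn)
  have hs : 0 < Real.sin (2 * d) := Real.sin_pos_of_pos_of_lt_pi (by linarith) (by linarith)
  have hc : 0 < Real.cos d := Real.cos_pos_of_mem_Ioo ⟨by linarith, by linarith⟩
  have hsd : 0 < Real.sin d := Real.sin_pos_of_pos_of_lt_pi (by linarith) (by linarith)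
  have hconv := convex_convexHull ℝ
    {w : ℂ | ∃ k < n, w = Complex.exp (2 * Real.pi * Complex.I / n) ^ k}
  have h0 := zero_mem_convexHull_roots n (by omega)
  have hv1 := subset_convexHull ℝ
    {w : ℂ | ∃ k < n, w = Complex.exp (2 * Real.pi * Complex.I / n) ^ k} ⟨0, by omega, rfl⟩
  have hv2 := subset_convexHull ℝ
    {w : ℂ | ∃ k < n, w = Complex.exp (2 * Real.pi * Complex.I / n) ^ k} ⟨1, by omega, rfl⟩
  rw [exp_pow_eq_exp_mul_I] at hv1 hv2
  have s1 : 0 ≤ Real.sin (d - φ) :=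
    Real.sin_nonneg_of_nonneg_of_le_pi (by linarith [hφ.2]) (by linarith [hφ.1])
  have s2 : 0 ≤ Real.sin (d + φ) :=
    Real.sin_nonneg_of_nonneg_of_le_pi (by linarith [hφ.1]) (by linarith [hφ.2])
  set a : ℝ := r * Real.sin (d - φ) / Real.sin (2 * d) with ha
  set b : ℝ := r * Real.sin (d + φ) / Real.sin (2 * d) with hb
  have ha0 : 0 ≤ a := by positivity
  have hb0 : 0 ≤ b := by positivity
  have hab : a + b ≤ 1 := by
    rw [ha, hb, ← add_div, div_le_one hs, Real.sin_sub, Real.sin_add, Real.sin_two_mul]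
    nlinarith
  have hmem := (hconv.sum_mem (t := Finset.univ) (w := ![1 - a - b, a, b])
    (z := ![0, _, _]) (by
      intro i _; fin_cases i <;> simp <;> linarith) (by
      simp [Fin.sum_univ_three]; ring) (by
      intro i _; fin_cases i
      · exact h0
      · exact hv1
      · exact hv2))
  convert hmem using 1
  have hs' : Real.sin (2 * d) ≠ 0 := hs.ne'
  simp only [Fin.sum_univ_three, Matrix.cons_val_zero, Matrix.cons_val_one, Matrix.cons_val,
    smul_zero, zero_add]
  have eb : b * Real.sin (2 * d) = r * Real.sin (φ + d) := by
    rw [hb, add_comm d, div_mul_cancel₀ _ hs']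
  have ea : a + b * Real.cos (2 * d) = r * Real.cos (φ + d) := by
    have ea' : a * Real.sin (2 * d) = r * Real.sin (2 * d - (φ + d)) := by
      rw [ha, div_mul_cancel₀ _ hs', show 2 * d - (φ + d) = d - φ by ring]
    rw [Real.sin_sub] at ea'
    apply mul_right_cancel₀ hs'
    linear_combination ea' + Real.cos (2 * d) * eb
  apply Complex.ext
  · simp only [Complex.add_re, Complex.smul_re, Complex.re_ofReal_mul,
      Complex.exp_ofReal_mul_I_re, smul_eq_mul]
    simp only [Nat.cast_zero, Nat.cast_one, mul_zero, zero_mul, mul_one, Real.cos_zero]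
    rw [← hd]
    exact ea.symm
  · simp only [Complex.add_im, Complex.smul_im, Complex.im_ofReal_mul,
      Complex.exp_ofReal_mul_I_im, smul_eq_mul]
    simp only [Nat.cast_zero, Nat.cast_one, mul_zero, zero_mul, mul_one, Real.sin_zero, zero_add]
    rw [← hd]
    exact eb.symm

theorem image_pow_convexHull_roots_eq (n : ℕ) (hn : 3 ≤ n) :
    (fun z : ℂ => z ^ n) '' convexHull ℝ
        {w : ℂ | ∃ k < n, w = Complex.exp (2 * Real.pi * Complex.I / n) ^ k} =
      secantHalfPlanes n := by
  refine Set.Subset.antisymm ?_ ?_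
  · rintro _ ⟨z, hz, rfl⟩
    exact pow_mem_secantHalfPlanes n hn hz
  · intro w hw
    obtain ⟨ρ, θ, hρ, hθ, rfl⟩ := exists_eq_neg_mul_exp w
    rw [neg_mul_exp_mem_secantHalfPlanes_iff n hn hρ hθ] at hw
    have hpi := Real.pi_pos
    have hn' : (0 : ℝ) < n := by exact_mod_cast (by omega : 0 < n)
    have hd3 : Real.pi / n ≤ Real.pi / 3 :=
      div_le_div_of_nonneg_left hpi.le (by norm_num) (by exact_mod_cast hn)
    have hc : 0 ≤ Real.cos (Real.pi / n) :=
      Real.cos_nonneg_of_mem_Icc ⟨by linarith [div_pos hpi hn'], by linarith⟩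
    have hr : 0 ≤ ρ ^ ((1 : ℝ) / n) := by positivity
    have hrn : (ρ ^ ((1 : ℝ) / n)) ^ n = ρ := by
      rw [one_div, Real.rpow_inv_natCast_pow hρ (by omega)]
    refine ⟨_, mul_exp_mem_convexHull_roots n hn hr (φ := θ / n)
      ⟨by rw [← neg_div]; exact div_le_div_of_nonneg_right hθ.1 hn'.le,
        div_le_div_of_nonneg_right hθ.2 hn'.le⟩ ?_, ?_⟩
    · refine le_of_pow_le_pow_left₀ (n := n) (by omega) hc ?_
      rwa [mul_pow, hrn]
    · have hnc : (n : ℂ) ≠ 0 := by exact_mod_cast hn'.ne'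
      have e : (n : ℂ) * ((θ / n + Real.pi / n : ℝ) * Complex.I) =
          θ * Complex.I + Real.pi * Complex.I := by
        push_cast
        field_simp
      simp only
      rw [mul_pow, ← Complex.exp_nat_mul, e, Complex.exp_add, Complex.exp_pi_mul_I,
        ← Complex.ofReal_pow, hrn]
      ring

/-- `𝒫_n^n` equals the convex hull of the secant-parametrized boundary curve. -/
theorem polygon_pow_eq_convexHull_secant_curve (n : ℕ) (hn : 3 ≤ n) :
    (fun z : ℂ => z ^ n) '' convexHull ℝ
        {w : ℂ | ∃ k < n, w = Complex.exp (2 * Real.pi * Complex.I / n) ^ k} =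
    convexHull ℝ
      {w : ℂ | ∃ θ ∈ Set.Icc (-Real.pi) Real.pi,
        w = -((((Real.cos (θ / n))⁻¹ / (Real.cos (Real.pi / n))⁻¹) ^ n : ℝ) : ℂ) *
          Complex.exp (θ * Complex.I)} := by
  rw [image_pow_convexHull_roots_eq n hn]
  have hpi := Real.pi_pos
  have hn' : (0 : ℝ) < n := by exact_mod_cast (by omega : 0 < n)
  have hd3 : Real.pi / n ≤ Real.pi / 3 :=
    div_le_div_of_nonneg_left hpi.le (by norm_num) (by exact_mod_cast hn)
  have hcos {θ : ℝ} (hθ : θ ∈ Set.Icc (-Real.pi) Real.pi) : 0 < Real.cos (θ / n) := by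
    have h1 : -(Real.pi / n) ≤ θ / n := by
      rw [← neg_div]; exact div_le_div_of_nonneg_right hθ.1 hn'.le
    have h2 : θ / n ≤ Real.pi / n := div_le_div_of_nonneg_right hθ.2 hn'.le
    exact Real.cos_pos_of_mem_Ioo ⟨by linarith, by linarith⟩
  have hpim : Real.pi ∈ Set.Icc (-Real.pi) Real.pi := ⟨by linarith, le_rfl⟩
  have h0m : (0 : ℝ) ∈ Set.Icc (-Real.pi) Real.pi := ⟨by linarith, hpi.le⟩
  have hc := hcos hpim
  refine Set.Subset.antisymm ?_ (convexHull_min ?_ (convex_secantHalfPlanes n))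
  · intro w hw
    obtain ⟨ρ, θ, hρ, hθ, rfl⟩ := exists_eq_neg_mul_exp w
    rw [neg_mul_exp_mem_secantHalfPlanes_iff n hn hρ hθ] at hw
    set S := {w : ℂ | ∃ θ ∈ Set.Icc (-Real.pi) Real.pi,
        w = -((((Real.cos (θ / n))⁻¹ / (Real.cos (Real.pi / n))⁻¹) ^ n : ℝ) : ℂ) *
          Complex.exp (θ * Complex.I)} with hS
    have hconv := convex_convexHull ℝ S
    have hone : (1 : ℂ) ∈ convexHull ℝ S := by
      refine subset_convexHull ℝ S ⟨Real.pi, hpim, ?_⟩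
      rw [div_self (inv_ne_zero hc.ne'), Complex.exp_pi_mul_I]
      simp
    have hneg : ((-Real.cos (Real.pi / n) ^ n : ℝ) : ℂ) ∈ convexHull ℝ S := by
      refine subset_convexHull ℝ S ⟨0, h0m, ?_⟩
      simp
    have hzero : (0 : ℂ) ∈ convexHull ℝ S := by
      have hp : 0 < Real.cos (Real.pi / n) ^ n := pow_pos hc n
      set t := Real.cos (Real.pi / n) ^ n
      have := hconv hone hneg (a := t / (1 + t)) (b := 1 / (1 + t)) (by positivity)
        (by positivity) (by field_simp; ring)
      convert this using 1
      simp only [Complex.real_smul, mul_one, ← Complex.ofReal_mul, ← Complex.ofReal_add]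
      rw [← Complex.ofReal_zero]
      congr 1
      ring
    have hcθ := hcos hθ
    have hmem := hconv.smul_mem_of_zero_mem hzero (subset_convexHull ℝ S ⟨θ, hθ, rfl⟩)
      (t := ρ * Real.cos (θ / n) ^ n / Real.cos (Real.pi / n) ^ n)
      ⟨by positivity, (div_le_one (pow_pos hc n)).2 hw⟩
    convert hmem using 1
    rw [Complex.real_smul, ← mul_assoc, mul_neg, ← Complex.ofReal_mul]
    congr 4
    rw [div_pow, inv_pow, inv_pow]
    field_simp
  · rintro w ⟨θ, hθ, rfl⟩
    have hcθ := hcos hθ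
    rw [neg_mul_exp_mem_secantHalfPlanes_iff n hn (by positivity) hθ]
    refine le_of_eq ?_
    rw [div_pow, inv_pow, inv_pow]
    field_simp
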